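/- Covariance of the theta kernel under the inversion σ_n: for M symmetric positive definite, (det M)^{n/2}(1/i)^{mn/2} ∫_{ℝ^{m×n}} F_{Ω,Z}(y)·exp(−2πi·tr(M y ᵗx)) dy = (det Ω)^{-m/2}·exp(−πi·tr(M(ZΩ^{-1}ᵗZ + xΩ^{-1}ᵗx − 2ZΩ^{-1}ᵗx))), where F_{Ω,Z}(y) = exp(πi·tr(M(yΩᵗy + 2yᵗZ))) and det^{±m/2} uses the holomorphic branch with det(Ω/i)^{1/2} positive for Ω = iY, Y real positive definite. -/

import Mathlib

open MeasureTheory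

open Matrix

noncomputable section

/-- Cast a real matrix to a complex matrix entrywise. -/
def mc {k l : ℕ} (A : Matrix (Fin k) (Fin l) ℝ) : Matrix (Fin k) (Fin l) ℂ :=
  A.map Complex.ofReal

/-- The Siegel upper half plane: symmetric with positive definite imaginary part. -/
def InSiegel {n : ℕ} (Ω : Matrix (Fin n) (Fin n) ℂ) : Prop :=
  Ω.IsSymm ∧ (Ω.map Complex.im).PosDef

/-- The theta kernel `F_{Ω,Z}(x) = exp(πi·tr(M(xΩᵗx + 2xᵗZ)))`. -/
def thetaKernel {n m : ℕ} (M : Matrix (Fin m) (Fin m) ℝ)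
    (Ω : Matrix (Fin n) (Fin n) ℂ) (Z : Matrix (Fin m) (Fin n) ℂ)
    (x : Matrix (Fin m) (Fin n) ℂ) : ℂ :=
  Complex.exp ((Real.pi : ℂ) * Complex.I *
    (mc M * (x * Ω * xᵀ + (2 : ℂ) • (x * Zᵀ))).trace)

/-- Symmetric complex matrices with positive definite real part. -/
def InS {n : ℕ} (S : Matrix (Fin n) (Fin n) ℂ) : Prop :=
  S.IsSymm ∧ (S.map Complex.re).PosDef

open Kronecker in
/-- The Jacobian of `y ↦ N y ᵗP` on matrices with `m` rows and `n` columns. -/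
theorem integral_comp_mul_mul_transpose {m n : ℕ} (N : Matrix (Fin m) (Fin m) ℝ)
    (P : Matrix (Fin n) (Fin n) ℝ) (hN : N.det ≠ 0) (hP : P.det ≠ 0)
    (g : (Fin m → Fin n → ℝ) → ℂ) :
    ∫ y : Fin m → Fin n → ℝ, g (N * of y * Pᵀ) =
      ((|N.det| ^ n * |P.det| ^ m)⁻¹ : ℝ) * ∫ u, g u := by
  let e : (Fin n × Fin m → ℝ) ≃ₗ[ℝ] (Fin m → Fin n → ℝ) :=
    { toFun := fun v i j => v (j, i)
      invFun := fun y p => y p.2 p.1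
      map_add' := fun _ _ => rfl
      map_smul' := fun _ _ => rfl
      left_inv := fun _ => rfl
      right_inv := fun _ => rfl }
  let L : (Fin m → Fin n → ℝ) →ₗ[ℝ] (Fin m → Fin n → ℝ) :=
    (e : _ →ₗ[ℝ] _) ∘ₗ Matrix.toLin' (P ⊗ₖ N) ∘ₗ (e.symm : _ →ₗ[ℝ] _)
  have hL (y : Fin m → Fin n → ℝ) : L y = N * of y * Pᵀ := by
    ext i j
    exact congrFun (kronecker_mulVec_vec N (of y) P) (j, i)
  have hdet : LinearMap.det L = P.det ^ m * N.det ^ n := by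
    simp only [L, LinearMap.det_conj, LinearMap.det_toLin', det_kronecker, Fintype.card_fin]
  have hdet0 : LinearMap.det L ≠ 0 := by rw [hdet]; positivity
  have hcont : Continuous L := L.continuous_of_finiteDimensional
  have hinj : Function.Injective L := (LinearMap.equivOfDetNeZero L hdet0).injective
  have hemb : MeasurableEmbedding L := hcont.measurableEmbedding hinj
  have := hemb.integral_map (μ := volume) g
  rw [Measure.map_linearMap_addHaar_eq_smul_addHaar volume hdet0, integral_smul_measure,
    ENNReal.toReal_ofReal (abs_nonneg _), hdet] at this
  simp only [hL] at this
  rw [← this, abs_inv, abs_mul, abs_pow, abs_pow, Complex.real_smul, mul_comm (|N.det| ^ n)]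

/-- A separable complex Gaussian integral over matrices. -/
theorem integral_cexp_gaussian_matrix {m n : ℕ} (d : Fin n → ℂ) (hd : ∀ j, 0 < (d j).re)
    (V : Matrix (Fin m) (Fin n) ℂ) :
    ∫ u : Fin m → Fin n → ℝ, Complex.exp (∑ i, ∑ j,
        (-(Real.pi * d j) * (u i j : ℂ) ^ 2 + 2 * Real.pi * Complex.I * V i j * u i j)) =
      ((∏ j, d j ^ (1 / 2 : ℂ)) ^ m)⁻¹ *
        Complex.exp (-Real.pi * ∑ i, ∑ j, V i j ^ 2 / d j) := by
  have hd0 (j) : d j ≠ 0 := fun h => by simpa [h] using hd j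
  have hpi : (Real.pi : ℂ) ≠ 0 := by exact_mod_cast Real.pi_ne_zero
  have h1 (i j) : ∫ x : ℝ, Complex.exp (-(Real.pi * d j) * (x : ℂ) ^ 2
      + 2 * Real.pi * Complex.I * V i j * x) =
      (d j ^ (1 / 2 : ℂ))⁻¹ * Complex.exp (-Real.pi * (V i j ^ 2 / d j)) := by
    have hb : (-(Real.pi * d j)).re < 0 := by
      simpa using mul_pos Real.pi_pos (hd j)
    have := integral_cexp_quadratic hb (2 * Real.pi * Complex.I * V i j) 0
    simp only [add_zero] at this
    rw [this]
    congr 1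
    · rw [neg_neg, ← Complex.inv_cpow _ _ fun h => ?_]
      · congr 1
        field_simp
      · have := Complex.arg_eq_pi_iff.1 h
        linarith [hd j, this.1]
    · congr 1
      have := hd0 j
      field_simp
      simp only [Complex.I_sq]
      ring
  simp_rw [Complex.exp_sum]
  rw [integral_fintype_prod_volume_eq_prod (f := fun i (v : Fin n → ℝ) => ∏ j,
    Complex.exp (-(Real.pi * d j) * (v j : ℂ) ^ 2 + 2 * Real.pi * Complex.I * V i j * v j))]
  have h2 (i) : ∫ v : Fin n → ℝ, ∏ j, Complex.exp (-(Real.pi * d j) * (v j : ℂ) ^ 2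
      + 2 * Real.pi * Complex.I * V i j * v j) = ∏ j,
      ((d j ^ (1 / 2 : ℂ))⁻¹ * Complex.exp (-Real.pi * (V i j ^ 2 / d j))) := by
    rw [integral_fintype_prod_volume_eq_prod (f := fun j (x : ℝ) =>
      Complex.exp (-(Real.pi * d j) * (x : ℂ) ^ 2 + 2 * Real.pi * Complex.I * V i j * x))]
    exact Finset.prod_congr rfl fun j _ => h1 i j
  simp_rw [h2, Finset.prod_mul_distrib, Finset.mul_sum, Complex.exp_sum]
  simp

open scoped MatrixOrder Matrix.Norms.L2Operator in
theorem Matrix.PosDef.exists_eq_transpose_mul_self {n : ℕ} {A : Matrix (Fin n) (Fin n) ℝ}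
    (hA : A.PosDef) : ∃ N : Matrix (Fin n) (Fin n) ℝ, N.det ≠ 0 ∧ A = Nᵀ * N := by
  obtain ⟨N, hN⟩ := CStarAlgebra.nonneg_iff_eq_star_mul_self.1 hA.posSemidef.nonneg
  rw [star_eq_conjTranspose, conjTranspose_eq_transpose_of_trivial] at hN
  refine ⟨N, fun h => hA.det_pos.ne' ?_, hN⟩
  rw [hN, det_mul, h, mul_zero]

/-- Simultaneous diagonalization by congruence of a positive definite and a symmetric matrix. -/
theorem Matrix.PosDef.exists_simultaneous_diagonalization {n : ℕ}
    {A B : Matrix (Fin n) (Fin n) ℝ} (hA : A.PosDef) (hB : B.IsSymm) :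
    ∃ (P : Matrix (Fin n) (Fin n) ℝ) (b : Fin n → ℝ),
      P.det ≠ 0 ∧ A = Pᵀ * P ∧ B = Pᵀ * diagonal b * P := by
  obtain ⟨N, hN, rfl⟩ := hA.exists_eq_transpose_mul_self
  have hNu : IsUnit N.det := hN.isUnit
  have hNtu : IsUnit Nᵀ.det := by rwa [det_transpose]
  have hC : (N⁻¹ᵀ * B * N⁻¹).IsHermitian := by
    rw [IsHermitian, conjTranspose_eq_transpose_of_trivial]
    simp only [transpose_mul, transpose_transpose, hB.eq, Matrix.mul_assoc]
  have hspec := hC.spectral_theorem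
  rw [Unitary.conjStarAlgAut_apply] at hspec
  set U : Matrix (Fin n) (Fin n) ℝ := hC.eigenvectorUnitary.1
  have hU : U * star U = 1 := Unitary.coe_mul_star_self hC.eigenvectorUnitary
  have hstar : star U = Uᵀ := by
    rw [star_eq_conjTranspose, conjTranspose_eq_transpose_of_trivial]
  rw [hstar] at hspec hU
  have hUdet : U.det ≠ 0 := fun h => by
    simpa [h] using congrArg det hU
  refine ⟨Uᵀ * N, hC.eigenvalues, ?_, ?_, ?_⟩
  · rw [det_mul, det_transpose]
    exact mul_ne_zero hUdet hN
  · rw [transpose_mul, transpose_transpose, Matrix.mul_assoc, ← Matrix.mul_assoc U, hU,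
      Matrix.one_mul]
  · have hreal : (RCLike.ofReal ∘ hC.eigenvalues : Fin n → ℝ) = hC.eigenvalues := rfl
    rw [hreal] at hspec
    generalize hC.eigenvalues = b at hspec
    calc B = Nᵀ * (N⁻¹ᵀ * B * N⁻¹) * N := by
          rw [transpose_nonsing_inv, Matrix.mul_assoc, Matrix.mul_assoc, Matrix.mul_assoc,
            nonsing_inv_mul _ hNu, Matrix.mul_one, mul_nonsing_inv_cancel_left _ _ hNtu]
      _ = _ := by
          rw [hspec]
          simp only [transpose_mul, transpose_transpose, Matrix.mul_assoc]

theorem mc_mul {k l p : ℕ} (A : Matrix (Fin k) (Fin l) ℝ) (B : Matrix (Fin l) (Fin p) ℝ) :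
    mc (A * B) = mc A * mc B :=
  Matrix.map_mul (f := Complex.ofRealHom)

theorem mc_transpose {k l : ℕ} (A : Matrix (Fin k) (Fin l) ℝ) : mc Aᵀ = (mc A)ᵀ := rfl

theorem det_mc {k : ℕ} (A : Matrix (Fin k) (Fin k) ℝ) : (mc A).det = A.det :=
  (Complex.ofRealHom.map_det A).symm

theorem InS.congruence {n : ℕ} {P : Matrix (Fin n) (Fin n) ℝ} (hP : P.det ≠ 0) (b : Fin n → ℝ) :
    InS ((mc P)ᵀ * diagonal (fun j => 1 + Complex.I * b j) * mc P) := by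
  have hre : ((mc P)ᵀ * diagonal (fun j => 1 + Complex.I * b j) * mc P).map Complex.re
      = Pᵀ * P := by
    ext i j
    have hmul : ((mc P)ᵀ * diagonal (fun j => 1 + Complex.I * (b j : ℂ)) * mc P) i j =
        ∑ k, (P k i : ℂ) * (1 + Complex.I * b k) * P k j := by
      rw [Matrix.mul_apply]
      simp only [Matrix.mul_diagonal]
      rfl
    rw [Matrix.map_apply, hmul]
    simp [Matrix.mul_apply]
  refine ⟨?_, ?_⟩
  · rw [IsSymm]
    simp only [transpose_mul, transpose_transpose, diagonal_transpose, Matrix.mul_assoc]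
  · rw [hre, ← conjTranspose_eq_transpose_of_trivial]
    exact PosDef.conjTranspose_mul_self _
      (mulVec_injective_iff_isUnit.2 ((isUnit_iff_isUnit_det _).2 hP.isUnit))

/-- The value of the continuous branch of `det^{1/2}` on a diagonalized matrix. -/
theorem sqrt_det_branch_eq {n : ℕ} {sqD : Matrix (Fin n) (Fin n) ℂ → ℂ}
    (hcont : ContinuousOn sqD {S | InS S})
    (hsq : ∀ S, InS S → (sqD S) ^ 2 = S.det)
    (hposval : ∀ S : Matrix (Fin n) (Fin n) ℝ, S.PosDef → sqD (mc S) = Real.sqrt S.det)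
    {P : Matrix (Fin n) (Fin n) ℝ} (hP : P.det ≠ 0) (b : Fin n → ℝ) :
    sqD ((mc P)ᵀ * diagonal (fun j => 1 + Complex.I * b j) * mc P) =
      |P.det| * ∏ j, (1 + Complex.I * b j) ^ (1 / 2 : ℂ) := by
  let S : ℝ → Matrix (Fin n) (Fin n) ℂ := fun t =>
    (mc P)ᵀ * diagonal (fun j => 1 + Complex.I * ((t * b j : ℝ) : ℂ)) * mc P
  let g : ℝ → ℂ := fun t => |P.det| * ∏ j, (1 + Complex.I * ((t * b j : ℝ) : ℂ)) ^ (1 / 2 : ℂ)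
  have hS (t) : InS (S t) := InS.congruence hP _
  have hScont : Continuous S := by
    refine (continuous_const.matrix_mul (Continuous.matrix_diagonal ?_)).matrix_mul
      continuous_const
    fun_prop
  have hslit (t : ℝ) (j) : 1 + Complex.I * ((t * b j : ℝ) : ℂ) ∈ Complex.slitPlane := by
    left; simp
  have hgcont : Continuous g := by
    refine continuous_const.mul (continuous_finsetProd _ fun j _ => ?_)
    exact Continuous.cpow (by fun_prop) continuous_const fun t => hslit t j
  have hg0 (t) : g t ≠ 0 := by
    refine mul_ne_zero (by simpa using hP) (Finset.prod_ne_zero_iff.2 fun j _ => ?_)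
    rw [Complex.cpow_ne_zero_iff]
    exact Or.inl (Complex.slitPlane_ne_zero (hslit t j))
  have hsqg (t) : sqD (S t) ^ 2 = g t ^ 2 := by
    rw [hsq _ (hS t), det_mul, det_mul, det_transpose, det_diagonal, det_mc, mul_pow,
      ← Finset.prod_pow, ← Complex.ofReal_pow, sq_abs]
    have hroot (j : Fin n) : ((1 + Complex.I * ((t * b j : ℝ) : ℂ)) ^ (1 / 2 : ℂ)) ^ 2 =
        1 + Complex.I * ((t * b j : ℝ) : ℂ) := by
      rw [one_div]
      exact Complex.cpow_nat_inv_pow _ two_ne_zero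
    simp_rw [hroot]
    push_cast
    ring
  have h0 : sqD (S 0) = g 0 := by
    have hS0 : S 0 = mc (Pᵀ * P) := by
      simp only [S, zero_mul, Complex.ofReal_zero, mul_zero, add_zero]
      rw [diagonal_one, Matrix.mul_one, mc_mul, mc_transpose]
    have hpd : (Pᵀ * P).PosDef := by
      rw [← conjTranspose_eq_transpose_of_trivial]
      exact PosDef.conjTranspose_mul_self _
        (mulVec_injective_iff_isUnit.2 ((isUnit_iff_isUnit_det _).2 hP.isUnit))
    rw [hS0, hposval _ hpd, det_mul, det_transpose, Real.sqrt_mul_self_eq_abs]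
    simp [g]
  have := isPreconnected_univ.eq_of_sq_eq (f := fun t => sqD (S t)) (g := g)
    (hcont.comp_continuous hScont hS).continuousOn hgcont.continuousOn
    (fun t _ => hsqg t) (fun {t} _ => hg0 t) (Set.mem_univ 0) h0 (Set.mem_univ 1)
  simpa [S, g] using this

theorem trace_mul_diagonal_mul_transpose {m n : ℕ} (u : Matrix (Fin m) (Fin n) ℂ)
    (d : Fin n → ℂ) : (u * diagonal d * uᵀ).trace = ∑ i, ∑ j, d j * u i j ^ 2 := by
  simp only [trace, diag_apply, Matrix.mul_apply (N := uᵀ), Matrix.mul_diagonal, transpose_apply]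
  exact Finset.sum_congr rfl fun i _ => Finset.sum_congr rfl fun j _ => by ring

theorem trace_mul_transpose {m n : ℕ} (u V : Matrix (Fin m) (Fin n) ℂ) :
    (u * Vᵀ).trace = ∑ i, ∑ j, V i j * u i j := by
  simp only [trace, diag_apply, Matrix.mul_apply, transpose_apply, mul_comm]

/-- The Fourier-type Gaussian integral over `m × n` matrices with quadratic form
`y ↦ tr(ᵗN N y S ᵗy)`, where `S = ᵗP D P`. -/
theorem integral_cexp_trace {m n : ℕ} {N : Matrix (Fin m) (Fin m) ℝ}
    {P : Matrix (Fin n) (Fin n) ℝ} (hN : N.det ≠ 0) (hP : P.det ≠ 0) {d : Fin n → ℂ}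
    (hd : ∀ j, 0 < (d j).re) (W : Matrix (Fin m) (Fin n) ℂ) :
    ∫ y : Fin m → Fin n → ℝ, Complex.exp
        (-Real.pi * (mc (Nᵀ * N) * (mc (of y) * ((mc P)ᵀ * diagonal d * mc P) *
            (mc (of y))ᵀ)).trace
          + 2 * Real.pi * Complex.I * (mc (Nᵀ * N) * (mc (of y) * Wᵀ)).trace) =
      ((|N.det| ^ n * |P.det| ^ m)⁻¹ : ℝ) * (((∏ j, d j ^ (1 / 2 : ℂ)) ^ m)⁻¹ *
        Complex.exp (-Real.pi *
          (mc (Nᵀ * N) * (W * ((mc P)ᵀ * diagonal d * mc P)⁻¹ * Wᵀ)).trace)) := by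
  have hd0 (j) : d j ≠ 0 := fun h => by simpa [h] using hd j
  have hPu : IsUnit (mc P).det := by simpa [det_mc] using hP
  have hPtu : IsUnit (mc P)ᵀ.det := by rwa [det_transpose]
  have hdinv : (diagonal d)⁻¹ = diagonal (fun j => (d j)⁻¹) :=
    inv_eq_right_inv (by simp [diagonal_mul_diagonal, hd0])
  let V : Matrix (Fin m) (Fin n) ℂ := mc N * W * (mc P)⁻¹
  have hquad (y : Matrix (Fin m) (Fin n) ℝ) :
      (mc (Nᵀ * N) * (mc y * ((mc P)ᵀ * diagonal d * mc P) * (mc y)ᵀ)).trace =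
        ∑ i, ∑ j, d j * mc (N * y * Pᵀ) i j ^ 2 := by
    rw [← trace_mul_diagonal_mul_transpose]
    simp only [mc_mul, mc_transpose, transpose_mul, transpose_transpose, Matrix.mul_assoc]
    rw [trace_mul_comm]
    simp only [Matrix.mul_assoc]
  have hlin (y : Matrix (Fin m) (Fin n) ℝ) :
      (mc (Nᵀ * N) * (mc y * Wᵀ)).trace = ∑ i, ∑ j, V i j * mc (N * y * Pᵀ) i j := by
    rw [← trace_mul_transpose]
    simp only [V, mc_mul, mc_transpose, transpose_mul, Matrix.mul_assoc, transpose_nonsing_inv]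
    rw [mul_nonsing_inv_cancel_left _ _ hPtu, trace_mul_comm]
    simp only [Matrix.mul_assoc]
  have hres : (mc (Nᵀ * N) * (W * ((mc P)ᵀ * diagonal d * mc P)⁻¹ * Wᵀ)).trace =
      ∑ i, ∑ j, V i j ^ 2 / d j := by
    have := trace_mul_diagonal_mul_transpose V (fun j => (d j)⁻¹)
    simp only [div_eq_inv_mul]
    rw [← this, Matrix.mul_inv_rev, Matrix.mul_inv_rev, hdinv]
    simp only [V, mc_mul, mc_transpose, transpose_mul, Matrix.mul_assoc, transpose_nonsing_inv]
    rw [trace_mul_comm]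
    simp only [Matrix.mul_assoc]
  rw [hres, ← integral_cexp_gaussian_matrix d hd V,
    ← integral_comp_mul_mul_transpose N P hN hP]
  refine integral_congr_ae (Filter.Eventually.of_forall fun y => ?_)
  simp only [hquad, hlin, Finset.mul_sum, ← Finset.sum_add_distrib]
  congr 1
  refine Finset.sum_congr rfl fun i _ => Finset.sum_congr rfl fun j _ => ?_
  simp only [mc, Matrix.map_apply]
  ring

/-- Covariance of the theta kernel under the inversion `σ_n`:
`(det M)^{n/2}(1/i)^{mn/2} ∫ F_{Ω,Z}(y) e^{−2πi tr(MyᵗX)} dy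
  = (det Ω)^{-m/2} e^{−πi tr(M(ZΩ⁻¹ᵗZ + xΩ⁻¹ᵗx − 2ZΩ⁻¹ᵗx))}`,
where `sqD` is the holomorphic branch of `det^{1/2}` on matrices with positive definite
real part, positive on real positive definite matrices, and
`(det Ω)^{1/2} = i^{n/2}·sqD(Ω/i)`. -/
theorem theta_kernel_inversion_covariance {n m : ℕ}
    (sqD : Matrix (Fin n) (Fin n) ℂ → ℂ)
    (hcont : ContinuousOn sqD {S | InS S})
    (hsq : ∀ S, InS S → (sqD S) ^ 2 = S.det)
    (hposval : ∀ S : Matrix (Fin n) (Fin n) ℝ, S.PosDef → sqD (mc S) = Real.sqrt S.det)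
    (M : Matrix (Fin m) (Fin m) ℝ) (hM : M.IsSymm) (hMpos : M.PosDef)
    (Ω : Matrix (Fin n) (Fin n) ℂ) (hΩ : InSiegel Ω) (Z : Matrix (Fin m) (Fin n) ℂ)
    (x : Matrix (Fin m) (Fin n) ℝ) :
    ((M.det : ℂ) ^ ((n : ℂ) / 2)) * ((1 / Complex.I) ^ (((m * n : ℕ) : ℂ) / 2)) *
      (∫ y : Fin m → Fin n → ℝ,
        thetaKernel M Ω Z (mc (Matrix.of y)) *
          Complex.exp ((-2 : ℂ) * (Real.pi : ℂ) * Complex.I *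
            (mc M * (mc (Matrix.of y) * (mc x)ᵀ)).trace))
    = (Complex.I ^ ((n : ℂ) / 2) * sqD ((-Complex.I) • Ω)) ^ (-(m : ℤ)) *
      Complex.exp (-(Real.pi : ℂ) * Complex.I *
        (mc M * (Z * Ω⁻¹ * Zᵀ + mc x * Ω⁻¹ * (mc x)ᵀ
          - (2 : ℂ) • (Z * Ω⁻¹ * (mc x)ᵀ))).trace) := by
  obtain ⟨P, b, hP, hA, hB⟩ := hΩ.2.exists_simultaneous_diagonalization
    (B := -Ω.map Complex.re) (by
      ext i j
      simpa using congrArg Complex.re (hΩ.1.apply i j))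
  obtain ⟨N, hN, rfl⟩ := hMpos.exists_eq_transpose_mul_self
  set d : Fin n → ℂ := fun j => 1 + Complex.I * b j with hd_def
  have hd (j) : 0 < (d j).re := by simp [d]
  set S := (mc P)ᵀ * diagonal d * mc P with hS_def
  have hS : (-Complex.I) • Ω = S := by
    have hdiag : diagonal d = 1 + Complex.I • mc (diagonal b) := by
      ext i j
      by_cases h : i = j
      · subst h; simp [d, mc]
      · simp [mc, h]
    have hSsum : S = mc (Pᵀ * P) + Complex.I • mc (Pᵀ * diagonal b * P) := by
      rw [hS_def, hdiag, Matrix.mul_add, Matrix.add_mul]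
      simp [mc_mul, mc_transpose]
    rw [hSsum, ← hA, ← hB]
    ext i j
    apply Complex.ext <;> simp [mc]
  have hSdet : S.det ≠ 0 := by
    rw [hS_def, det_mul, det_mul, det_transpose, det_mc, det_diagonal]
    have : ∏ j, d j ≠ 0 := Finset.prod_ne_zero_iff.2 fun j _ h => by simpa [h] using hd j
    have : (P.det : ℂ) ≠ 0 := by exact_mod_cast hP
    positivity
  have hΩS : Ω = Complex.I • S := by rw [← hS, smul_smul]; simp
  have hSinv : S⁻¹ = Complex.I • Ω⁻¹ := by
    have : Ω⁻¹ = (-Complex.I) • S⁻¹ := by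
      refine inv_eq_right_inv ?_
      rw [hΩS, Matrix.smul_mul, Matrix.mul_smul, mul_nonsing_inv _ hSdet.isUnit, smul_smul]
      simp
    rw [this, smul_smul]
    simp
  have hΩinv : (Ω⁻¹)ᵀ = Ω⁻¹ := by rw [transpose_nonsing_inv, hΩ.1.eq]
  have hintegrand (y : Fin m → Fin n → ℝ) :
      thetaKernel (Nᵀ * N) Ω Z (mc (Matrix.of y)) *
          Complex.exp ((-2 : ℂ) * (Real.pi : ℂ) * Complex.I *
            (mc (Nᵀ * N) * (mc (Matrix.of y) * (mc x)ᵀ)).trace) =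
      Complex.exp (-Real.pi * (mc (Nᵀ * N) * (mc (of y) * S * (mc (of y))ᵀ)).trace
          + 2 * Real.pi * Complex.I * (mc (Nᵀ * N) * (mc (of y) * (Z - mc x)ᵀ)).trace) := by
    rw [thetaKernel, ← Complex.exp_add, hΩS]
    congr 1
    simp only [Matrix.mul_add, Matrix.mul_sub, transpose_sub, Matrix.mul_smul, Matrix.smul_mul,
      trace_add, trace_sub, trace_smul, smul_eq_mul]
    linear_combination (Real.pi * (mc (Nᵀ * N) * (mc (of y) * S * (mc (of y))ᵀ)).trace) *
      Complex.I_sq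
  have hsymm : (mc (Nᵀ * N) * (mc x * Ω⁻¹ * Zᵀ)).trace =
      (mc (Nᵀ * N) * (Z * Ω⁻¹ * (mc x)ᵀ)).trace := by
    rw [← trace_transpose, transpose_mul, ← mc_transpose, hM.eq, trace_mul_comm]
    simp only [transpose_mul, transpose_transpose, hΩinv, Matrix.mul_assoc]
  have hexp : Complex.exp (-Real.pi *
        (mc (Nᵀ * N) * ((Z - mc x) * S⁻¹ * (Z - mc x)ᵀ)).trace) =
      Complex.exp (-(Real.pi : ℂ) * Complex.I *
        (mc (Nᵀ * N) * (Z * Ω⁻¹ * Zᵀ + mc x * Ω⁻¹ * (mc x)ᵀ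
          - (2 : ℂ) • (Z * Ω⁻¹ * (mc x)ᵀ))).trace) := by
    congr 1
    rw [hSinv]
    simp only [Matrix.mul_add, Matrix.mul_sub, Matrix.sub_mul, transpose_sub, Matrix.mul_smul,
      Matrix.smul_mul, trace_add, trace_sub, trace_smul, smul_eq_mul, hsymm]
    ring
  have hdetM : (((Nᵀ * N).det : ℝ) : ℂ) ^ ((n : ℂ) / 2) = ((|N.det| ^ n : ℝ) : ℂ) := by
    have h : (Nᵀ * N).det = |N.det| ^ 2 := by rw [det_mul, det_transpose, sq_abs, sq]
    have h2 : ((n : ℂ) / 2) = ((n / 2 : ℝ) : ℂ) := by push_cast; rfl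
    rw [h, h2, ← Complex.ofReal_cpow (by positivity), ← Real.rpow_natCast_mul (abs_nonneg _)]
    congr 1
    rw [← Real.rpow_natCast]
    congr 1
    push_cast
    ring
  have hI : (1 / Complex.I) ^ (((m * n : ℕ) : ℂ) / 2) = ((Complex.I ^ ((n : ℂ) / 2)) ^ m)⁻¹ := by
    rw [one_div, Complex.inv_cpow _ _ (by simp [Complex.arg_I]; linarith [Real.pi_pos]),
      ← Complex.cpow_nat_mul]
    congr 2
    push_cast
    ring
  have hsqD := sqrt_det_branch_eq hcont hsq hposval hP b
  simp_rw [hintegrand]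
  rw [integral_cexp_trace hN hP hd, ← hS_def, hexp, hS, hS_def, hsqD, hdetM, hI, _root_.zpow_neg,
    _root_.zpow_natCast]
  have hN' : ((|N.det| : ℝ) : ℂ) ≠ 0 := by simpa using hN
  push_cast
  simp only [hd_def, mul_pow, mul_inv]
  field_simp
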